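/- Validity part of Theorem 2 (bounds under stochastic monotonicity and symmetry). Under the sample selection model with Assumptions 1 and 3, integrable Y₀*, Y₁*, continuous strictly increasing conditional CDF F₁ of Y given {D=1, S=1} (atomless with everywhere positive density), the positivity conditions, and Assumption 5 (symmetry: the conditional distribution of Y₁* given {S₀ = S₁ = 1} has a Lebesgue density that is symmetric about some point μ, i.e. f(μ+x) = f(μ−x) for all x), it holds that ∇̲ˢ ≤ τ ≤ ∇̄ˢ, where ∇̲ˢ := y¹_{ϑq₀/2} − E[Y | D=0, S=1] and ∇̄ˢ := y¹_{1−ϑq₀/2} − E[Y | D=0, S=1]. -/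

import Mathlib

open MeasureTheory ProbabilityTheory Set

noncomputable section

variable {Ω : Type*} [MeasurableSpace Ω]

/-- Probability of an event as a real number. -/
def pr (μ : Measure Ω) (A : Set Ω) : ℝ := (μ A).toReal

/-- Conditional probability `P(B | A)`. -/
def cpr (μ : Measure Ω) (A B : Set Ω) : ℝ := pr μ (A ∩ B) / pr μ A

/-- Conditional expectation of `X` given the event `A`. -/
def cexp (μ : Measure Ω) (X : Ω → ℝ) (A : Set Ω) : ℝ := (∫ ω in A, X ω ∂μ) / pr μ A

lemma aux_cond_real (μ : Measure Ω) {A : Set Ω} (hA : MeasurableSet A) (B : Set Ω) :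
    (μ[|A]).real B = pr μ (A ∩ B) / pr μ A := by
  rw [measureReal_def, cond_apply hA, ENNReal.toReal_mul, ENNReal.toReal_inv, pr, pr]
  ring

lemma aux_cond_integral (μ : Measure Ω) (A : Set Ω) (X : Ω → ℝ) :
    ∫ ω, X ω ∂(μ[|A]) = (∫ ω in A, X ω ∂μ) / pr μ A := by
  rw [ProbabilityTheory.cond, integral_smul_measure, ENNReal.toReal_inv, pr, smul_eq_mul]
  ring

lemma aux_setIntegral (ν : Measure Ω) {β : Type*} [MeasurableSpace β]
    {V : Ω → β} {Z : Ω → ℝ} (h : IndepFun V Z ν) (hV : Measurable V) (hZ : Measurable Z)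
    (g : β → ℝ) (hg : Measurable g) (c : ℝ) :
    ∫ ω in {ω | Z ω = c}, g (V ω) ∂ν = (∫ ω, g (V ω) ∂ν) * pr ν {ω | Z ω = c} := by
  have hm : MeasurableSet {ω | Z ω = c} := hZ (measurableSet_singleton c)
  have hgm : Measurable (({c} : Set ℝ).indicator (fun _ => (1 : ℝ))) :=
    measurable_const.indicator (measurableSet_singleton c)
  have := h.integral_fun_comp_mul_comp (f := g) (g := ({c} : Set ℝ).indicator (fun _ => (1 : ℝ)))
    hV.aemeasurable hZ.aemeasurable hg.aestronglyMeasurable hgm.aestronglyMeasurable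
  rw [← integral_indicator hm]
  have e1 : ({ω | Z ω = c}.indicator fun ω => g (V ω)) =
      fun ω => g (V ω) * ({c} : Set ℝ).indicator (fun _ => (1 : ℝ)) (Z ω) := by
    ext ω
    by_cases hz : Z ω = c <;> simp [indicator, hz]
  have e2 : (fun ω => ({c} : Set ℝ).indicator (fun _ => (1 : ℝ)) (Z ω)) =
      {ω | Z ω = c}.indicator (fun _ => (1 : ℝ)) := by
    ext ω
    by_cases hz : Z ω = c <;> simp [indicator, hz]
  rw [e1, this, e2, integral_indicator hm]
  simp [pr, measureReal_def]

lemma aux_symm (ν : Measure ℝ) [IsProbabilityMeasure ν] (f : ℝ → ℝ) (m : ℝ)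
    (hν : ν = volume.withDensity fun x => ENNReal.ofReal (f x))
    (hf : ∀ x : ℝ, f (m + x) = f (m - x)) (hi : Integrable (fun x => x) ν) :
    ∫ x, x ∂ν = m ∧ ν.real (Iic m) = 1 / 2 := by
  have hmp : MeasurePreserving (fun x : ℝ => 2 * m - x) volume volume :=
    volume.measurePreserving_sub_left (2 * m)
  have hemb : MeasurableEmbedding (fun x : ℝ => 2 * m - x) :=
    (MeasurableEquiv.subLeft (2 * m)).measurableEmbedding
  have hmap : ν.map (fun x : ℝ => 2 * m - x) = ν := by
    ext s hs
    rw [Measure.map_apply hmp.measurable hs]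
    conv_lhs => rw [hν]
    conv_rhs => rw [hν]
    rw [withDensity_apply _ (hmp.measurable hs), withDensity_apply _ hs,
      ← hmp.setLIntegral_comp_preimage_emb hemb (fun x => ENNReal.ofReal (f x)) s]
    refine lintegral_congr fun x => ?_
    have := hf (m - x)
    ring_nf at this ⊢
    rw [this]
  have hac : ν {m} = 0 := by
    rw [hν]
    exact withDensity_absolutelyContinuous _ _ (by simp)
  constructor
  · have h1 : ∫ x, x ∂ν = ∫ x, (2 * m - x) ∂ν := by
      conv_lhs => rw [← hmap]
      rw [hemb.integral_map]
    rw [integral_sub (integrable_const _) hi] at h1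
    simp at h1
    linarith
  · have h2 : ν.real (Iic m) = ν.real (Ici m) := by
      conv_lhs => rw [← hmap]
      rw [map_measureReal_apply hmp.measurable measurableSet_Iic]
      congr 1
      ext x
      simp only [mem_preimage, mem_Iic, mem_Ici]
      constructor <;> intro h <;> linarith
    have h3 : ν.real (Ioi m) = ν.real (Ici m) := by
      rw [measureReal_def, measureReal_def]
      congr 1
      apply le_antisymm (measure_mono Ioi_subset_Ici_self)
      rw [← Ioi_union_left]
      exact (measure_union_le _ _).trans (by rw [hac, add_zero])
    have h4 : ν.real (Iic m) + ν.real (Iic m)ᶜ = 1 := by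
      rw [measureReal_add_measureReal_compl measurableSet_Iic]; simp
    rw [compl_Iic] at h4
    linarith


/-- **Theorem 2 (validity part).** Under the sample selection model with Assumptions 1, 3
and the symmetry assumption (Assumption 5), `τ` lies between the quantile bounds
`∇̲ˢ = y¹_{ϑq₀/2} − E[Y | D=0, S=1]` and `∇̄ˢ = y¹_{1−ϑq₀/2} − E[Y | D=0, S=1]`. -/
theorem lee_bounds_symmetry_validity
    (μ : Measure Ω) [IsProbabilityMeasure μ]
    (Y1 Y0 S1 S0 D S Y : Ω → ℝ)
    (hY1m : Measurable Y1) (hY0m : Measurable Y0)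
    (hS1m : Measurable S1) (hS0m : Measurable S0) (hDm : Measurable D)
    (hS1v : ∀ ω, S1 ω = 0 ∨ S1 ω = 1) (hS0v : ∀ ω, S0 ω = 0 ∨ S0 ω = 1)
    (hDv : ∀ ω, D ω = 0 ∨ D ω = 1)
    (hS : ∀ ω, S ω = S1 ω * D ω + S0 ω * (1 - D ω))
    (hY : ∀ ω, Y ω = S ω * (Y1 ω * D ω + Y0 ω * (1 - D ω)))
    (hY1i : Integrable Y1 μ) (hY0i : Integrable Y0 μ)
    -- Assumption 1 (independent assignment)
    (hIndep : IndepFun (fun ω => (Y1 ω, Y0 ω, S1 ω, S0 ω)) D μ)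
    -- Assumption 3 (stochastic monotonicity)
    (ϑL : ℝ) (hϑL : ϑL ∈ Set.Ioc (0 : ℝ) 1)
    (hSM1 : ϑL ≤ cpr μ {ω | S0 ω = 1} {ω | S1 ω = 1})
    (hSM2 : IndepFun (fun ω => (Y1 ω, Y0 ω)) S1 (μ[|{ω | S0 ω = 1}]))
    -- identified quantities
    (α0 q0 ϑF ϑ τ : ℝ) (F1 : ℝ → ℝ) (yq : ℝ → ℝ)
    (hα0 : α0 = cpr μ {ω | D ω = 0} {ω | S ω = 1})
    (hq0 : q0 = cpr μ {ω | D ω = 0} {ω | S ω = 1} / cpr μ {ω | D ω = 1} {ω | S ω = 1})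
    (hϑF : ϑF = 1 + 1 / q0 - 1 / α0)
    (hϑ : ϑ = max ϑL ϑF)
    (hF1 : ∀ t, F1 t = cpr μ {ω | D ω = 1 ∧ S ω = 1} {ω | Y ω ≤ t})
    (hyq : ∀ r, yq r = sInf {t : ℝ | r ≤ F1 t})
    (hF1cont : Continuous F1) (hF1mono : StrictMono F1)
    (hτ : τ = cexp μ (fun ω => Y1 ω - Y0 ω) {ω | S0 ω = 1 ∧ S1 ω = 1})
    -- positivity conditions
    (hD1 : 0 < pr μ {ω | D ω = 1}) (hD1' : pr μ {ω | D ω = 1} < 1)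
    (hSD0 : 0 < pr μ {ω | S ω = 1 ∧ D ω = 0})
    (hSD1 : 0 < pr μ {ω | S ω = 1 ∧ D ω = 1})
    (hAT : 0 < pr μ {ω | S0 ω = 1 ∧ S1 ω = 1}) -- Assumption 5 (symmetry of the conditional density of Y1* for always-takers)
    (hsym : ∃ (f : ℝ → ℝ) (mc : ℝ),
      (Measure.map Y1 (μ[|{ω | S0 ω = 1 ∧ S1 ω = 1}])
          = volume.withDensity fun x => ENNReal.ofReal (f x)) ∧
        ∀ x : ℝ, f (mc + x) = f (mc - x)) :
    yq (ϑ * q0 / 2) - cexp μ Y {ω | D ω = 0 ∧ S ω = 1} ≤ τ ∧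
      τ ≤ yq (1 - ϑ * q0 / 2) - cexp μ Y {ω | D ω = 0 ∧ S ω = 1} := by
  have mS0 : MeasurableSet {ω | S0 ω = 1} := hS0m (measurableSet_singleton 1)
  have mS1 : MeasurableSet {ω | S1 ω = 1} := hS1m (measurableSet_singleton 1)
  have mD0 : MeasurableSet {ω | D ω = 0} := hDm (measurableSet_singleton 0)
  have mD1 : MeasurableSet {ω | D ω = 1} := hDm (measurableSet_singleton 1)
  have mA : MeasurableSet {ω | S0 ω = 1 ∧ S1 ω = 1} := mS0.inter mS1
  have hSm : Measurable S := by
    rw [show S = fun ω => S1 ω * D ω + S0 ω * (1 - D ω) from funext hS]; fun_prop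
  have hYm : Measurable Y := by
    rw [show Y = fun ω => S ω * (Y1 ω * D ω + Y0 ω * (1 - D ω)) from funext hY]; fun_prop
  have hVm : Measurable (fun ω => (Y1 ω, Y0 ω, S1 ω, S0 ω)) := by fun_prop
  have hWm : Measurable (fun ω => (Y1 ω, Y0 ω)) := by fun_prop
  -- independence, set version
  have hind : ∀ (s : Set (ℝ × ℝ × ℝ × ℝ)) (c : ℝ), MeasurableSet s →
      pr μ ({ω | (Y1 ω, Y0 ω, S1 ω, S0 ω) ∈ s} ∩ {ω | D ω = c}) =
        pr μ {ω | (Y1 ω, Y0 ω, S1 ω, S0 ω) ∈ s} * pr μ {ω | D ω = c} := by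
    intro s c hs
    have := hIndep.measure_inter_preimage_eq_mul s {c} hs (measurableSet_singleton c)
    rw [pr, pr, pr, ← ENNReal.toReal_mul]
    exact congrArg ENNReal.toReal this
  have eD0 : {ω | D ω = 0} ∩ {ω | S ω = 1} = {ω | S0 ω = 1} ∩ {ω | D ω = 0} := by
    ext ω
    simp only [mem_inter_iff, mem_ofPred_eq, hS ω]
    constructor
    · rintro ⟨h, h'⟩; rw [h] at h'; exact ⟨by linarith, h⟩
    · rintro ⟨h, h'⟩; rw [h, h']; norm_num
  have eD1 : {ω | D ω = 1} ∩ {ω | S ω = 1} = {ω | S1 ω = 1} ∩ {ω | D ω = 1} := by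
    ext ω
    simp only [mem_inter_iff, mem_ofPred_eq, hS ω]
    constructor
    · rintro ⟨h, h'⟩; rw [h] at h'; exact ⟨by linarith, h⟩
    · rintro ⟨h, h'⟩; rw [h, h']; norm_num
  have eD1Y : ∀ t, ({ω | D ω = 1} ∩ {ω | S ω = 1}) ∩ {ω | Y ω ≤ t} =
      {ω | S1 ω = 1 ∧ Y1 ω ≤ t} ∩ {ω | D ω = 1} := by
    intro t
    rw [eD1]
    ext ω
    simp only [mem_inter_iff, mem_ofPred_eq, hY ω, hS ω]
    constructor
    · rintro ⟨⟨h, h'⟩, h''⟩; rw [h, h'] at h''; exact ⟨⟨h, by linarith⟩, h'⟩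
    · rintro ⟨⟨h, h''⟩, h'⟩; rw [h, h']; exact ⟨⟨rfl, rfl⟩, by linarith⟩
  have i0 : pr μ ({ω | S0 ω = 1} ∩ {ω | D ω = 0}) = pr μ {ω | S0 ω = 1} * pr μ {ω | D ω = 0} :=
    hind {p | p.2.2.2 = 1} 0 (measurableSet_eq_fun (by fun_prop) (by fun_prop))
  have i1 : pr μ ({ω | S1 ω = 1} ∩ {ω | D ω = 1}) = pr μ {ω | S1 ω = 1} * pr μ {ω | D ω = 1} :=
    hind {p | p.2.2.1 = 1} 1 (measurableSet_eq_fun (by fun_prop) (by fun_prop))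
  have i2 : ∀ t, pr μ ({ω | S1 ω = 1 ∧ Y1 ω ≤ t} ∩ {ω | D ω = 1}) =
      pr μ {ω | S1 ω = 1 ∧ Y1 ω ≤ t} * pr μ {ω | D ω = 1} := fun t =>
    hind {p | p.2.2.1 = 1 ∧ p.1 ≤ t} 1
      ((measurableSet_eq_fun (f := fun p : ℝ × ℝ × ℝ × ℝ => p.2.2.1) (g := fun _ => 1)
        (by fun_prop) (by fun_prop)).inter
        (measurableSet_le (f := fun p : ℝ × ℝ × ℝ × ℝ => p.1) (g := fun _ => t)
          (by fun_prop) (by fun_prop)))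
  rw [show {ω | S ω = 1 ∧ D ω = 0} = {ω | D ω = 0} ∩ {ω | S ω = 1} from
    by ext ω; simp [and_comm], eD0, i0] at hSD0
  rw [show {ω | S ω = 1 ∧ D ω = 1} = {ω | D ω = 1} ∩ {ω | S ω = 1} from
    by ext ω; simp [and_comm], eD1, i1] at hSD1
  have nn : ∀ s, 0 ≤ pr μ s := fun s => ENNReal.toReal_nonneg
  have pd0 : 0 < pr μ {ω | D ω = 0} := pos_of_mul_pos_right hSD0 (nn _)
  have pp0 : 0 < pr μ {ω | S0 ω = 1} := pos_of_mul_pos_left hSD0 (nn _)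
  have pp1 : 0 < pr μ {ω | S1 ω = 1} := pos_of_mul_pos_left hSD1 (nn _)
  have ma : ∀ {s t : Set Ω}, s ⊆ t → pr μ s ≤ pr μ t := fun h =>
    ENNReal.toReal_mono (measure_ne_top _ _) (measure_mono h)
  have ha0 : α0 = pr μ {ω | S0 ω = 1} := by
    rw [hα0, cpr, eD0, i0]; field_simp
  have ha1 : cpr μ {ω | D ω = 1} {ω | S ω = 1} = pr μ {ω | S1 ω = 1} := by
    rw [cpr, eD1, i1]; field_simp
  have hq : q0 = pr μ {ω | S0 ω = 1} / pr μ {ω | S1 ω = 1} := by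
    rw [hq0, ← hα0, ha0, ha1]
  have hF : ∀ t, F1 t = pr μ {ω | S1 ω = 1 ∧ Y1 ω ≤ t} / pr μ {ω | S1 ω = 1} := by
    intro t
    rw [hF1, cpr, show {ω | D ω = 1 ∧ S ω = 1} = {ω | D ω = 1} ∩ {ω | S ω = 1} from rfl,
      eD1Y, i2, eD1, i1]
    field_simp
  -- lower bound on the always-taker share
  have hincl : pr μ {ω | S0 ω = 1} + pr μ {ω | S1 ω = 1} ≤
      1 + pr μ {ω | S0 ω = 1 ∧ S1 ω = 1} := by
    have h := measureReal_union_add_inter (μ := μ) (s := {ω | S0 ω = 1}) mS1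
    have h' : μ.real ({ω | S0 ω = 1} ∪ {ω | S1 ω = 1}) ≤ 1 := measureReal_le_one
    have h'' : μ.real ({ω | S0 ω = 1} ∩ {ω | S1 ω = 1}) = pr μ {ω | S0 ω = 1 ∧ S1 ω = 1} := rfl
    have h3 : μ.real {ω | S0 ω = 1} = pr μ {ω | S0 ω = 1} := rfl
    have h4 : μ.real {ω | S1 ω = 1} = pr μ {ω | S1 ω = 1} := rfl
    linarith
  have hth : ϑ * pr μ {ω | S0 ω = 1} ≤ pr μ {ω | S0 ω = 1 ∧ S1 ω = 1} := by
    rw [← le_div_iff₀ pp0, hϑ]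
    refine max_le hSM1 ?_
    rw [hϑF, hq, ha0, le_div_iff₀ pp0]
    have : (1 + 1 / (pr μ {ω | S0 ω = 1} / pr μ {ω | S1 ω = 1}) - 1 / pr μ {ω | S0 ω = 1}) *
        pr μ {ω | S0 ω = 1} = pr μ {ω | S0 ω = 1} + pr μ {ω | S1 ω = 1} - 1 := by
      field_simp
    linarith
  have hϑpos : 0 < ϑ := by rw [hϑ]; exact lt_max_of_lt_left hϑL.1
  have hrpos : 0 < ϑ * q0 := by rw [hq]; positivity
  have hr : ϑ * q0 ≤ pr μ {ω | S0 ω = 1 ∧ S1 ω = 1} / pr μ {ω | S1 ω = 1} := by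
    rw [hq, ← mul_div_assoc]; gcongr
  -- expectation of Y0
  have hY0D : ∫ ω in {ω | D ω = 0 ∧ S ω = 1}, Y ω ∂μ =
      (∫ ω in {ω | S0 ω = 1}, Y0 ω ∂μ) * pr μ {ω | D ω = 0} := by
    have hg : Measurable (fun p : ℝ × ℝ × ℝ × ℝ => p.2.2.2 * p.2.1) := by fun_prop
    have h := aux_setIntegral μ hIndep hVm hDm _ hg 0
    have e : ∫ ω, S0 ω * Y0 ω ∂μ = ∫ ω in {ω | S0 ω = 1}, Y0 ω ∂μ := by
      rw [← integral_indicator mS0]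
      congr 1
      ext ω
      rcases hS0v ω with h | h <;> simp [indicator, h]
    rw [← e]
    refine Eq.trans ?_ h
    rw [← integral_indicator mD0,
      show {ω | D ω = 0 ∧ S ω = 1} = {ω | D ω = 0} ∩ {ω | S ω = 1} from rfl,
      eD0, ← integral_indicator (mS0.inter mD0)]
    congr 1
    ext ω
    rcases hS0v ω with h | h <;> rcases hDv ω with h' | h' <;> simp [indicator, h, h', hY, hS]
  have hcY : cexp μ Y {ω | D ω = 0 ∧ S ω = 1} =
      (∫ ω in {ω | S0 ω = 1}, Y0 ω ∂μ) / pr μ {ω | S0 ω = 1} := by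
    rw [cexp, hY0D, show {ω | D ω = 0 ∧ S ω = 1} = {ω | D ω = 0} ∩ {ω | S ω = 1} from rfl,
      eD0, i0]
    field_simp
  have hY0A : (∫ ω in {ω | S0 ω = 1 ∧ S1 ω = 1}, Y0 ω ∂μ) / pr μ {ω | S0 ω = 1 ∧ S1 ω = 1} =
      (∫ ω in {ω | S0 ω = 1}, Y0 ω ∂μ) / pr μ {ω | S0 ω = 1} := by
    have h := aux_setIntegral _ hSM2 hWm hS1m (fun p => p.2) measurable_snd 1
    have e1 : pr (μ[|{ω | S0 ω = 1}]) {ω | S1 ω = 1} =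
        pr μ {ω | S0 ω = 1 ∧ S1 ω = 1} / pr μ {ω | S0 ω = 1} := aux_cond_real μ mS0 _
    rw [e1, ← integral_indicator mS1, aux_cond_integral, aux_cond_integral,
      integral_indicator mS1, Measure.restrict_restrict mS1,
      show {ω | S1 ω = 1} ∩ {ω | S0 ω = 1} = {ω | S0 ω = 1 ∧ S1 ω = 1} from
        by ext ω; simp [and_comm]] at h
    simp only at h
    field_simp at h ⊢
    linarith
  -- the symmetric law
  obtain ⟨f, m, hfd, hfs⟩ := hsym
  have hA0 : μ {ω | S0 ω = 1 ∧ S1 ω = 1} ≠ 0 := by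
    intro h; rw [pr, h] at hAT; simp at hAT
  have : IsProbabilityMeasure (μ[|{ω | S0 ω = 1 ∧ S1 ω = 1}]) := cond_isProbabilityMeasure hA0
  have := Measure.isProbabilityMeasure_map
    (μ := μ[|{ω | S0 ω = 1 ∧ S1 ω = 1}]) hY1m.aemeasurable
  have hY1c : Integrable Y1 (μ[|{ω | S0 ω = 1 ∧ S1 ω = 1}]) := by
    rw [ProbabilityTheory.cond]
    exact hY1i.integrableOn.smul_measure (ENNReal.inv_ne_top.2 hA0)
  have hint : Integrable (fun x : ℝ => x) (Measure.map Y1 (μ[|{ω | S0 ω = 1 ∧ S1 ω = 1}])) :=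
    (integrable_map_measure measurable_id.aestronglyMeasurable hY1m.aemeasurable).2 hY1c
  obtain ⟨hmean, hmed⟩ := aux_symm _ f m hfd hfs hint
  have hmean' : (∫ ω in {ω | S0 ω = 1 ∧ S1 ω = 1}, Y1 ω ∂μ) /
      pr μ {ω | S0 ω = 1 ∧ S1 ω = 1} = m := by
    rw [← aux_cond_integral, ← hmean]
    exact (integral_map hY1m.aemeasurable measurable_id.aestronglyMeasurable).symm
  have hmed' : pr μ ({ω | S0 ω = 1 ∧ S1 ω = 1} ∩ {ω | Y1 ω ≤ m}) =
      pr μ {ω | S0 ω = 1 ∧ S1 ω = 1} / 2 := by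
    rw [map_measureReal_apply hY1m measurableSet_Iic] at hmed
    have h := aux_cond_real μ mA (Y1 ⁻¹' Iic m)
    rw [hmed] at h
    have h' : {ω | S0 ω = 1 ∧ S1 ω = 1} ∩ {ω | Y1 ω ≤ m} =
      {ω | S0 ω = 1 ∧ S1 ω = 1} ∩ Y1 ⁻¹' Iic m := rfl
    rw [h']
    field_simp at h
    linarith
  have hτ' : τ = m - cexp μ Y {ω | D ω = 0 ∧ S ω = 1} := by
    rw [hτ, cexp, integral_sub hY1i.integrableOn hY0i.integrableOn, sub_div, hmean', hY0A, hcY]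
  -- bounds on F1 m
  have hlow : ϑ * q0 / 2 ≤ F1 m := by
    have h1 : pr μ {ω | S0 ω = 1 ∧ S1 ω = 1} / 2 ≤ pr μ {ω | S1 ω = 1 ∧ Y1 ω ≤ m} := by
      rw [← hmed']
      exact ma fun ω h => ⟨h.1.2, h.2⟩
    have h2 := div_le_div_of_nonneg_right h1 pp1.le
    rw [hF]
    calc ϑ * q0 / 2 ≤ pr μ {ω | S0 ω = 1 ∧ S1 ω = 1} / pr μ {ω | S1 ω = 1} / 2 := by gcongr
      _ = pr μ {ω | S0 ω = 1 ∧ S1 ω = 1} / 2 / pr μ {ω | S1 ω = 1} := by ring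
      _ ≤ _ := h2
  have hup : F1 m ≤ 1 - ϑ * q0 / 2 := by
    have mYm : MeasurableSet {ω | Y1 ω ≤ m} := hY1m measurableSet_Iic
    have h1 : pr μ ({ω | S0 ω = 1 ∧ S1 ω = 1} ∩ {ω | Y1 ω ≤ m}) +
        pr μ ({ω | S0 ω = 1 ∧ S1 ω = 1} \ {ω | Y1 ω ≤ m}) = pr μ {ω | S0 ω = 1 ∧ S1 ω = 1} :=
      measureReal_inter_add_sdiff (μ := μ) (s := {ω | S0 ω = 1 ∧ S1 ω = 1}) mYm
    have h2 : pr μ ({ω | S1 ω = 1} ∩ {ω | Y1 ω ≤ m}) +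
        pr μ ({ω | S1 ω = 1} \ {ω | Y1 ω ≤ m}) = pr μ {ω | S1 ω = 1} :=
      measureReal_inter_add_sdiff (μ := μ) (s := {ω | S1 ω = 1}) mYm
    have h3 : pr μ ({ω | S0 ω = 1 ∧ S1 ω = 1} \ {ω | Y1 ω ≤ m}) ≤
        pr μ ({ω | S1 ω = 1} \ {ω | Y1 ω ≤ m}) := ma fun ω h => ⟨h.1.2, h.2⟩
    have h4 : pr μ {ω | S1 ω = 1 ∧ Y1 ω ≤ m} ≤
        pr μ {ω | S1 ω = 1} - pr μ {ω | S0 ω = 1 ∧ S1 ω = 1} / 2 := by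
      have : pr μ {ω | S1 ω = 1 ∧ Y1 ω ≤ m} = pr μ ({ω | S1 ω = 1} ∩ {ω | Y1 ω ≤ m}) := rfl
      linarith
    rw [hF, div_le_iff₀ pp1]
    rw [le_div_iff₀ pp1] at hr
    linarith
  -- limits of F1
  have hB0 : μ {ω | D ω = 1 ∧ S ω = 1} ≠ 0 := by
    intro h
    have h1 : pr μ ({ω | D ω = 1} ∩ {ω | S ω = 1}) = 0 := by
      rw [pr]
      exact (congrArg ENNReal.toReal h).trans ENNReal.toReal_zero
    rw [eD1, i1] at h1
    linarith
  have : IsProbabilityMeasure (μ[|{ω | D ω = 1 ∧ S ω = 1}]) := cond_isProbabilityMeasure hB0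
  have := Measure.isProbabilityMeasure_map
    (μ := μ[|{ω | D ω = 1 ∧ S ω = 1}]) hYm.aemeasurable
  have hcdf : F1 = cdf (Measure.map Y (μ[|{ω | D ω = 1 ∧ S ω = 1}])) := by
    ext t
    rw [cdf_eq_real, map_measureReal_apply hYm measurableSet_Iic, hF1]
    exact (aux_cond_real μ (mD1.inter (hSm (measurableSet_singleton 1))) _).symm
  have hbot := tendsto_cdf_atBot (Measure.map Y (μ[|{ω | D ω = 1 ∧ S ω = 1}]))
  have htop := tendsto_cdf_atTop (Measure.map Y (μ[|{ω | D ω = 1 ∧ S ω = 1}]))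
  rw [← hcdf] at hbot htop
  rw [hτ']
  constructor
  · gcongr
    rw [hyq]
    refine csInf_le ?_ hlow
    obtain ⟨b, hb⟩ := (hbot.eventually (gt_mem_nhds (half_pos hrpos))).exists
    refine ⟨b, fun t ht => ?_⟩
    exact (hF1mono.lt_iff_lt.1 (lt_of_lt_of_le hb ht)).le
  · gcongr
    rw [hyq]
    refine le_csInf ?_ fun t ht => hF1mono.le_iff_le.1 (hup.trans ht)
    have : 1 - ϑ * q0 / 2 < 1 := by linarith
    obtain ⟨b, hb⟩ := (htop.eventually (lt_mem_nhds this)).exists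
    exact ⟨b, hb.le⟩


end
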